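/- The marginal density p is differentiable on ℝ^d, and for every x ∈ ℝ^d the gradient of the log marginal density satisfies ∇ log p(x) = −(x − α·m(x))/β², where m(x) is the posterior mean of y given x. -/

import Mathlib

open MeasureTheory

theorem aux_integrable {E F : Type*} [NormedAddCommGroup E] [MeasurableSpace E]
    [BorelSpace E] [SecondCountableTopology E] [NormedAddCommGroup F]
    (μ : Measure E) [IsProbabilityMeasure μ] (K : Set E) (hK : IsCompact K) (hμK : μ Kᶜ = 0)
    (f : E → F) (hf : Continuous f) : Integrable f μ := by
  obtain ⟨C, hC⟩ := hK.exists_bound_of_continuousOn hf.continuousOn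
  refine Integrable.of_bound hf.aestronglyMeasurable C ?_
  have : ∀ᵐ y ∂μ, y ∈ K := hμK
  filter_upwards [this] with y hy using hC y hy

/-- The marginal density `p` is differentiable on ℝ^d, and for every `x`
the gradient of the log marginal density satisfies `∇ log p x = −(x − α•m x)/β²`,
where `m x` is the posterior mean of `y` given `x`. -/
theorem stmt_3
    (d : ℕ) (hd : 1 ≤ d)
    (α β : ℝ) (hα : 0 < α) (hβ : 0 < β)
    (μ : Measure (EuclideanSpace ℝ (Fin d))) [IsProbabilityMeasure μ]
    (K : Set (EuclideanSpace ℝ (Fin d))) (hK : IsCompact K) (hμK : μ Kᶜ = 0)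
    (g : EuclideanSpace ℝ (Fin d) → EuclideanSpace ℝ (Fin d) → ℝ)
    (hg : ∀ x y, g x y =
      (2 * Real.pi * β ^ 2) ^ (-(d : ℝ) / 2) * Real.exp (-‖x - α • y‖ ^ 2 / (2 * β ^ 2)))
    (p : EuclideanSpace ℝ (Fin d) → ℝ)
    (hp : ∀ x, p x = ∫ y, g x y ∂μ)
    (hppos : ∀ x, 0 < p x)
    (m : EuclideanSpace ℝ (Fin d) → EuclideanSpace ℝ (Fin d))
    (hm : ∀ x, m x = (p x)⁻¹ • ∫ y, g x y • y ∂μ) :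
    Differentiable ℝ p ∧
      ∀ x, gradient (fun x => Real.log (p x)) x = -((β ^ 2)⁻¹ • (x - α • m x)) := by
  have hgc : Continuous (fun q : EuclideanSpace ℝ (Fin d) × EuclideanSpace ℝ (Fin d) =>
      g q.1 q.2) := by
    simp only [hg]
    fun_prop
  have hgx : ∀ x, Continuous (g x) := fun x => hgc.comp (by fun_prop : Continuous fun y => (x, y))
  let G : EuclideanSpace ℝ (Fin d) → EuclideanSpace ℝ (Fin d) → EuclideanSpace ℝ (Fin d) :=
    fun x y => -((β ^ 2)⁻¹ • (g x y • (x - α • y)))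
  have hGc : Continuous (fun q : EuclideanSpace ℝ (Fin d) × EuclideanSpace ℝ (Fin d) =>
      G q.1 q.2) := by
    simp only [G]
    fun_prop
  have hGx : ∀ x, Continuous (G x) := fun x => hGc.comp (by fun_prop : Continuous fun y => (x, y))
  have hgd : ∀ x y, HasFDerivAt (fun x => g x y) (innerSL ℝ (G x y)) x := by
    intro x y
    have h1 : HasFDerivAt (fun x : EuclideanSpace ℝ (Fin d) => x - α • y)
        (ContinuousLinearMap.id ℝ _) x := (hasFDerivAt_id x).sub_const _
    have h2 := ((h1.norm_sq.neg.mul_const ((2 * β ^ 2)⁻¹)).exp).const_mul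
      ((2 * Real.pi * β ^ 2) ^ (-(d : ℝ) / 2))
    have h3 : (fun x => g x y) = fun x => (2 * Real.pi * β ^ 2) ^ (-(d : ℝ) / 2) *
        Real.exp (-‖x - α • y‖ ^ 2 * (2 * β ^ 2)⁻¹) := by
      funext x
      rw [hg, div_eq_mul_inv _ (2 * β ^ 2)]
    rw [h3]
    refine h2.congr_fderiv ?_
    ext v
    have hgxy := hg x y
    rw [div_eq_mul_inv _ (2 * β ^ 2)] at hgxy
    simp [G, inner_smul_left, hgxy]
    field_simp
  have hpd : ∀ x, HasFDerivAt p (∫ y, innerSL ℝ (G x y) ∂μ) x := by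
    intro x
    have hpe : p = fun x => ∫ y, g x y ∂μ := funext hp
    rw [hpe]
    obtain ⟨C, hC⟩ := ((isCompact_closedBall x 1).prod hK).exists_bound_of_continuousOn
      hGc.continuousOn
    have hae : ∀ᵐ y ∂μ, y ∈ K := hμK
    refine hasFDerivAt_integral_of_dominated_of_fderiv_le (s := Metric.closedBall x 1)
      (F' := fun x y => innerSL ℝ (G x y))
      (bound := fun _ => C) (Metric.closedBall_mem_nhds x one_pos)
      (Filter.Eventually.of_forall fun x => (hgx x).aestronglyMeasurable)
      (aux_integrable μ K hK hμK _ (hgx x))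
      ((innerSL ℝ).continuous.comp (hGx x)).aestronglyMeasurable ?_ (integrable_const C)
      (Filter.Eventually.of_forall fun y x _ => hgd x y)
    filter_upwards [hae] with y hy z hz
    rw [innerSL_apply_norm]
    exact hC (z, y) ⟨hz, hy⟩
  refine ⟨fun x => (hpd x).differentiableAt, fun x => ?_⟩
  apply HasGradientAt.gradient
  rw [hasGradientAt_iff_hasFDerivAt]
  refine ((hpd x).log (hppos x).ne').congr_fderiv ?_
  have hi1 : Integrable (g x) μ := aux_integrable μ K hK hμK _ (hgx x)
  have hi2 : Integrable (fun y => g x y • y) μ :=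
    aux_integrable μ K hK hμK _ ((hgx x).smul continuous_id)
  have hI : ∫ y, G x y ∂μ = -((β ^ 2)⁻¹ • (p x • x - α • ∫ y, g x y • y ∂μ)) := by
    have : ∀ y, G x y = -((β ^ 2)⁻¹ • (g x y • x - α • (g x y • y))) := by
      intro y
      simp only [G, smul_sub, smul_comm α (g x y) y]
    simp only [this]
    have hi3 : Integrable (fun y => α • (g x y • y)) μ := hi2.smul α
    rw [integral_neg, integral_smul, integral_sub (hi1.smul_const x) hi3,
      integral_smul, integral_smul_const, hp x]
  have hI2 : ∫ y, innerSL ℝ (G x y) ∂μ = innerSL ℝ (∫ y, G x y ∂μ) :=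
    (innerSL ℝ).integral_comp_comm (aux_integrable μ K hK hμK _ (hGx x))
  have hv : -((β ^ 2)⁻¹ • (x - α • m x)) = (p x)⁻¹ • ∫ y, G x y ∂μ := by
    rw [hI, hm x, smul_neg, smul_comm (p x)⁻¹, smul_sub (p x)⁻¹, smul_smul (p x)⁻¹ (p x),
      inv_mul_cancel₀ (hppos x).ne', one_smul, smul_comm (p x)⁻¹ α]
  rw [hI2, hv]
  ext v
  simp [inner_smul_left]
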